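/- arXiv:1012.4778 — 3 statements merged into one kernel-verified Lean document; each statement's English description precedes it below -/
import Mathlib

section
/- Let T > 0, let I and J be absolutely continuous nonnegative real-valued functions on [0,T] with J ∈ L²(0,T), and let a, c ∈ L¹(0,T) and b ∈ L²(0,T) be nonnegative functions. If I′(t) + J(t)² ≤ a(t)·I(t) + b(t)·J(t) + c(t) for a.e. t ∈ [0,T], then ‖J‖_{L²(0,T)} ≤ C_a · ( √(I(0)) + √(‖c‖_{L¹(0,T)}) + ‖b‖_{L²(0,T)} ), where C_a = 1 + A·e^A and A = ‖a‖_{L¹(0,T)}. In particular the constant depends only on ‖a‖_{L¹(0,T)}. -/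
open MeasureTheory

/-- `f` is absolutely continuous on `[0,T]` with (a.e.) derivative `f'`:
`f'` is Lebesgue integrable on `(0,T)` and `f t = f 0 + ∫₀ᵗ f' s ds` on `[0,T]`. -/
def IsACOn (f f' : ℝ → ℝ) (T : ℝ) : Prop :=
  IntegrableOn f' (Set.Ioc 0 T) ∧ ∀ t ∈ Set.Icc 0 T, f t = f 0 + ∫ s in (0:ℝ)..t, f' s

/-- `‖f‖_{L¹(0,t)} = ∫₀ᵗ |f s| ds`. -/
noncomputable def L1N (f : ℝ → ℝ) (t : ℝ) : ℝ := ∫ s in (0:ℝ)..t, |f s|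

/-- `‖f‖_{L²(0,t)} = (∫₀ᵗ f s ^ 2 ds)^{1/2}`. -/
noncomputable def L2N (f : ℝ → ℝ) (t : ℝ) : ℝ := Real.sqrt (∫ s in (0:ℝ)..t, (f s)^2)

/-- `‖f‖_{L^∞(0,T)}`: the essential supremum of `|f|` on `(0,T)`. -/
noncomputable def LInfN (f : ℝ → ℝ) (T : ℝ) : ℝ :=
  essSup (fun t => |f t|) (MeasureTheory.volume.restrict (Set.Ioo 0 T))

/-- The exponential of an absolutely continuous function is absolutely continuous. -/
theorem AbsolutelyContinuousOnInterval.exp {f : ℝ → ℝ} {x y : ℝ}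
    (hf : AbsolutelyContinuousOnInterval f x y) :
    AbsolutelyContinuousOnInterval (fun t => Real.exp (f t)) x y := by
  obtain ⟨C, hC⟩ := hf.exists_bound
  obtain ⟨K, hK⟩ := (Real.contDiff_exp (n := 1)).contDiffOn.exists_lipschitzOnWith
    (by decide) (convex_Icc (-C) C) isCompact_Icc
  have hmem : ∀ t ∈ Set.uIcc x y, f t ∈ Set.Icc (-C) C := fun t ht => abs_le.mp (hC t ht)
  rw [absolutelyContinuousOnInterval_iff] at hf ⊢
  intro ε hε
  obtain ⟨δ, hδ, h⟩ := hf (ε / (K + 1)) (by positivity)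
  refine ⟨δ, hδ, fun E hE hEδ => ?_⟩
  calc ∑ i ∈ Finset.range E.1, dist (Real.exp (f (E.2 i).1)) (Real.exp (f (E.2 i).2))
      ≤ ∑ i ∈ Finset.range E.1, (K + 1) * dist (f (E.2 i).1) (f (E.2 i).2) := by
        refine Finset.sum_le_sum fun i hi => ?_
        refine (hK.dist_le_mul _ (hmem _ (hE.1 i hi).1) _ (hmem _ (hE.1 i hi).2)).trans ?_
        gcongr
        linarith
    _ = (K + 1) * ∑ i ∈ Finset.range E.1, dist (f (E.2 i).1) (f (E.2 i).2) := by
        rw [Finset.mul_sum]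
    _ < (K + 1) * (ε / (K + 1)) := by
        gcongr
        exact h E hE hEδ
    _ = ε := by field_simp

/-- A nonnegative function with integrable square is in `L²`, without assuming measurability. -/
theorem memLp_two_of_nonneg_of_integrable_sq {α : Type*} [MeasurableSpace α] {μ : Measure α}
    {f : α → ℝ} (hf : 0 ≤ᵐ[μ] f) (hint : Integrable (fun t => (f t) ^ 2) μ) : MemLp f 2 μ := by
  have hmeas : AEStronglyMeasurable f μ := by
    refine (Real.continuous_sqrt.comp_aestronglyMeasurable hint.1).congr ?_
    filter_upwards [hf] with t ht
    exact Real.sqrt_sq ht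
  exact (memLp_two_iff_integrable_sq hmeas).2 hint

/-- The Cauchy–Schwarz inequality for a weighted integral. -/
theorem sq_integral_weight_mul_le {α : Type*} [MeasurableSpace α] {μ : Measure α}
    {m u v : α → ℝ} (hm : 0 ≤ᵐ[μ] m) (huu : Integrable (fun t => m t * (u t) ^ 2) μ)
    (huv : Integrable (fun t => m t * (v t * u t)) μ)
    (hvv : Integrable (fun t => m t * (v t) ^ 2) μ) :
    (∫ t, m t * (v t * u t) ∂μ) ^ 2 ≤ (∫ t, m t * (u t) ^ 2 ∂μ) * ∫ t, m t * (v t) ^ 2 ∂μ := by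
  have h : ∀ x : ℝ, 0 ≤ (∫ t, m t * (u t) ^ 2 ∂μ) * (x * x) +
      (2 * ∫ t, m t * (v t * u t) ∂μ) * x + ∫ t, m t * (v t) ^ 2 ∂μ := by
    intro x
    have hnn : 0 ≤ ∫ t, ((x * x) * (m t * (u t) ^ 2) + (2 * x) * (m t * (v t * u t))) +
        m t * (v t) ^ 2 ∂μ := by
      refine integral_nonneg_of_ae ?_
      filter_upwards [hm] with t ht
      have : 0 ≤ m t * (x * u t + v t) ^ 2 := mul_nonneg ht (sq_nonneg _)
      simp only [Pi.zero_apply]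
      linarith
    rw [integral_add ((huu.const_mul _).fun_add (huv.const_mul _)) hvv,
      integral_add (huu.const_mul _) (huv.const_mul _), integral_const_mul,
      integral_const_mul] at hnn
    linarith
  have := discrim_le_zero h
  rw [discrim] at this
  linarith

/-- Grönwall's inequality with integrating factor, for an absolutely continuous function. -/
theorem exp_mul_sub_le_integral_of_deriv_le {T : ℝ} (hT : 0 ≤ T) {I I' a g : ℝ → ℝ}
    (hI : IsACOn I I' T) (ha : IntegrableOn a (Set.Ioc 0 T))
    (hg : IntegrableOn g (Set.Ioc 0 T))
    (h : ∀ᵐ t ∂(volume.restrict (Set.Ioc 0 T)), I' t ≤ a t * I t + g t) :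
    Real.exp (-∫ s in (0:ℝ)..T, a s) * I T - I 0 ≤
      ∫ t in Set.Ioc 0 T, Real.exp (-∫ s in (0:ℝ)..t, a s) * g t := by
  obtain ⟨hI', hIeq⟩ := hI
  have hI'i : IntervalIntegrable I' volume 0 T :=
    (intervalIntegrable_iff_integrableOn_Ioc_of_le hT).2 hI'
  have hai : IntervalIntegrable a volume 0 T :=
    (intervalIntegrable_iff_integrableOn_Ioc_of_le hT).2 ha
  have hgi : IntervalIntegrable g volume 0 T :=
    (intervalIntegrable_iff_integrableOn_Ioc_of_le hT).2 hg
  set m : ℝ → ℝ := fun t => Real.exp (-∫ s in (0:ℝ)..t, a s) with hm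
  set y : ℝ → ℝ := fun t => I 0 + ∫ s in (0:ℝ)..t, I' s with hy
  have hmac : AbsolutelyContinuousOnInterval m 0 T :=
    (hai.absolutelyContinuousOnInterval_intervalIntegral (c := 0) (by simp)).fun_neg.exp
  have hyac : AbsolutelyContinuousOnInterval y 0 T :=
    (contDiffOn_const.absolutelyContinuousOnInterval).fun_add
      (hI'i.absolutelyContinuousOnInterval_intervalIntegral (c := 0) (by simp))
  have hparts := hmac.integral_deriv_mul_eq_sub hyac
  have hy0 : m 0 * y 0 = I 0 := by simp [hm, hy]
  have hyT : m T * y T = m T * I T := by rw [hIeq T ⟨hT, le_rfl⟩]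
  rw [hy0, hyT] at hparts
  rw [← hparts, ← intervalIntegral.integral_of_le hT]
  refine intervalIntegral.integral_mono_ae_restrict hT ?_ ?_ ?_
  · exact (hmac.intervalIntegrable_deriv.mul_continuousOn hyac.continuousOn).add
      (hyac.intervalIntegrable_deriv.continuousOn_mul hmac.continuousOn)
  · exact hgi.continuousOn_mul hmac.continuousOn
  · rw [← restrict_Ioc_eq_restrict_Icc]
    filter_upwards [h, ae_restrict_mem measurableSet_Ioc,
      ae_restrict_of_ae hai.ae_hasDerivAt_integral,
      ae_restrict_of_ae hI'i.ae_hasDerivAt_integral] with t ht htmem hat hIt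
    have htI : t ∈ Set.Icc 0 T := Set.Ioc_subset_Icc_self htmem
    have htu : t ∈ Set.uIcc 0 T := by rwa [Set.uIcc_of_le hT]
    have hdm : deriv m t = m t * -a t := (hat htu 0 (by simp)).neg.exp.deriv
    have hdy : deriv y t = I' t := ((hIt htu 0 (by simp)).const_add (I 0)).deriv
    have hyt : y t = I t := (hIeq t htI).symm
    rw [hdm, hdy, hyt]
    have hmt : 0 < m t := Real.exp_pos _
    nlinarith

theorem mixed_gronwall_L2_bound
    (T : ℝ) (hT : 0 < T) (I I' J J' a b c : ℝ → ℝ)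
    (hI : IsACOn I I' T) (hJ : IsACOn J J' T)
    (hInn : ∀ t ∈ Set.Icc 0 T, 0 ≤ I t)
    (hJnn : ∀ t ∈ Set.Icc 0 T, 0 ≤ J t)
    (hJL2 : IntegrableOn (fun t => (J t)^2) (Set.Ioc 0 T))
    (haint : IntegrableOn a (Set.Ioc 0 T))
    (hcint : IntegrableOn c (Set.Ioc 0 T))
    (hbint : IntegrableOn (fun t => (b t)^2) (Set.Ioc 0 T))
    (hann : ∀ᵐ t ∂(volume.restrict (Set.Ioo 0 T)), 0 ≤ a t)
    (hbnn : ∀ᵐ t ∂(volume.restrict (Set.Ioo 0 T)), 0 ≤ b t)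
    (hcnn : ∀ᵐ t ∂(volume.restrict (Set.Ioo 0 T)), 0 ≤ c t)
    (hineq : ∀ᵐ t ∂(volume.restrict (Set.Ioo 0 T)),
      I' t + (J t)^2 ≤ a t * I t + b t * J t + c t)
    :
    L2N J T ≤ (1 + L1N a T * Real.exp (L1N a T)) *
      (Real.sqrt (I 0) + Real.sqrt (L1N c T) + L2N b T) := by
  set μ := volume.restrict (Set.Ioc (0:ℝ) T) with hμ
  rw [restrict_Ioo_eq_restrict_Ioc] at hann hbnn hcnn hineq
  have hJae : 0 ≤ᵐ[μ] J := by
    filter_upwards [ae_restrict_mem measurableSet_Ioc] with t ht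
    exact hJnn t (Set.Ioc_subset_Icc_self ht)
  have hbJ : Integrable (fun t => b t * J t) μ :=
    (memLp_two_of_nonneg_of_integrable_sq hbnn hbint).integrable_mul
      (memLp_two_of_nonneg_of_integrable_sq hJae hJL2)
  have hai : IntervalIntegrable a volume 0 T :=
    (intervalIntegrable_iff_integrableOn_Ioc_of_le hT.le).2 haint
  set A := L1N a T with hA
  have hAeq : A = ∫ s in (0:ℝ)..T, a s := by
    rw [hA, L1N, intervalIntegral.integral_of_le hT.le, intervalIntegral.integral_of_le hT.le]
    refine integral_congr_ae ?_
    filter_upwards [hann] with t ht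
    exact abs_of_nonneg ht
  have hAnn : 0 ≤ A := intervalIntegral.integral_nonneg hT.le fun t _ => abs_nonneg _
  set m : ℝ → ℝ := fun t => Real.exp (-∫ s in (0:ℝ)..t, a s) with hm
  have hmcont : ContinuousOn m (Set.uIcc 0 T) :=
    (hai.absolutelyContinuousOnInterval_intervalIntegral
      (c := 0) (by simp)).fun_neg.exp.continuousOn
  have hmint : ∀ {f : ℝ → ℝ}, Integrable f μ → Integrable (fun t => m t * f t) μ := by
    intro f hf
    exact (intervalIntegrable_iff_integrableOn_Ioc_of_le hT.le).1
      (((intervalIntegrable_iff_integrableOn_Ioc_of_le hT.le).2 hf).continuousOn_mul hmcont)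
  have hmpos : ∀ t, 0 < m t := fun t => Real.exp_pos _
  have hmle : ∀ᵐ t ∂μ, m t ≤ 1 := by
    filter_upwards [ae_restrict_mem measurableSet_Ioc] with t ht
    refine Real.exp_le_one_iff.2 (neg_nonpos.2 ?_)
    rw [intervalIntegral.integral_of_le ht.1.le]
    exact integral_nonneg_of_ae
      (ae_restrict_of_ae_restrict_of_subset (Set.Ioc_subset_Ioc_right ht.2) hann)
  have hmge : ∀ᵐ t ∂μ, Real.exp (-A) ≤ m t := by
    filter_upwards [ae_restrict_mem measurableSet_Ioc] with t ht
    refine Real.exp_le_exp.2 (neg_le_neg ?_)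
    rw [hAeq, intervalIntegral.integral_of_le ht.1.le, intervalIntegral.integral_of_le hT.le]
    exact setIntegral_mono_set haint hann (Set.Ioc_subset_Ioc_right ht.2).eventuallyLE
  have hmono : ∀ {f : ℝ → ℝ}, Integrable f μ → 0 ≤ᵐ[μ] f →
      ∫ t, m t * f t ∂μ ≤ ∫ t, f t ∂μ := by
    intro f hf hfnn
    refine integral_mono_ae (hmint hf) hf ?_
    filter_upwards [hmle, hfnn] with t h1 h2
    exact mul_le_of_le_one_left h2 h1
  have hgron : Real.exp (-∫ s in (0:ℝ)..T, a s) * I T - I 0 ≤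
      ∫ t, m t * (b t * J t + c t - (J t) ^ 2) ∂μ := by
    refine exp_mul_sub_le_integral_of_deriv_le hT.le hI haint ((hbJ.add hcint).sub hJL2) ?_
    filter_upwards [hineq] with t ht
    linarith
  have hsplit : ∫ t, m t * (b t * J t + c t - (J t) ^ 2) ∂μ =
      ∫ t, m t * (b t * J t) ∂μ + ∫ t, m t * c t ∂μ - ∫ t, m t * (J t) ^ 2 ∂μ := by
    rw [← integral_add (hmint hbJ) (hmint hcint),
      ← integral_sub ((hmint hbJ).fun_add (hmint hcint)) (hmint hJL2)]
    congr 1 with t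
    ring
  have hIT : 0 ≤ Real.exp (-∫ s in (0:ℝ)..T, a s) * I T :=
    mul_nonneg (Real.exp_pos _).le (hInn T ⟨hT.le, le_rfl⟩)
  have hI0 : 0 ≤ I 0 := hInn 0 ⟨le_rfl, hT.le⟩
  have hcs := sq_integral_weight_mul_le (Filter.Eventually.of_forall fun t => (hmpos t).le)
    (hmint hJL2) (hmint hbJ) (hmint hbint)
  have hbm := hmono hbint (Filter.Eventually.of_forall fun t => sq_nonneg (b t))
  have hcL1 : L1N c T = ∫ t, c t ∂μ := by
    rw [L1N, intervalIntegral.integral_of_le hT.le]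
    refine integral_congr_ae ?_
    filter_upwards [hcnn] with t ht
    exact abs_of_nonneg ht
  have hcm : ∫ t, m t * c t ∂μ ≤ L1N c T := hcL1 ▸ hmono hcint hcnn
  have hJm : Real.exp (-A) * ∫ t, (J t) ^ 2 ∂μ ≤ ∫ t, m t * (J t) ^ 2 ∂μ := by
    rw [← integral_const_mul]
    refine integral_mono_ae (hJL2.const_mul _) (hmint hJL2) ?_
    filter_upwards [hmge] with t ht
    exact mul_le_mul_of_nonneg_right ht (sq_nonneg _)
  have hcL1nn : 0 ≤ L1N c T := intervalIntegral.integral_nonneg hT.le fun t _ => abs_nonneg _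
  set X := ∫ t, m t * (J t) ^ 2 ∂μ with hX
  set P := ∫ t, m t * (b t * J t) ∂μ with hP
  have hXnn : 0 ≤ X := integral_nonneg fun t => mul_nonneg (hmpos t).le (sq_nonneg _)
  have hL2b : L2N b T = √(∫ t, (b t) ^ 2 ∂μ) := by
    rw [L2N, intervalIntegral.integral_of_le hT.le]
  have hPle : P ≤ √X * L2N b T := by
    rw [hL2b, ← Real.sqrt_mul hXnn]
    exact Real.le_sqrt_of_sq_le (hcs.trans (mul_le_mul_of_nonneg_left hbm hXnn))
  have hXle : √X ≤ √(I 0) + √(L1N c T) + L2N b T := by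
    have h1 := Real.sq_sqrt hXnn
    have h2 := Real.sq_sqrt hI0
    have h3 := Real.sq_sqrt hcL1nn
    have h4 := Real.sqrt_nonneg (I 0)
    have h5 := Real.sqrt_nonneg (L1N c T)
    have h6 : 0 ≤ L2N b T := Real.sqrt_nonneg _
    by_contra! hlt
    nlinarith [mul_nonneg h4 h5, mul_nonneg h4 h6, mul_nonneg h5 h6]
  have hJX : L2N J T ≤ Real.exp A * √X := by
    rw [L2N, intervalIntegral.integral_of_le hT.le]
    refine Real.sqrt_le_iff.2 ⟨by positivity, ?_⟩
    have hE : Real.exp A * Real.exp (-A) = 1 := by rw [← Real.exp_add]; simp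
    rw [mul_pow, Real.sq_sqrt hXnn]
    calc ∫ t, (J t) ^ 2 ∂μ = Real.exp A * (Real.exp (-A) * ∫ t, (J t) ^ 2 ∂μ) := by
          rw [← mul_assoc, hE, one_mul]
      _ ≤ Real.exp A * X := by gcongr
      _ ≤ Real.exp A ^ 2 * X := by
          have : 1 ≤ Real.exp A := Real.one_le_exp hAnn
          gcongr
          nlinarith
  have hexp : Real.exp A ≤ 1 + A * Real.exp A := by
    have h1 := Real.add_one_le_exp (-A)
    have hE : Real.exp A * Real.exp (-A) = 1 := by rw [← Real.exp_add]; simp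
    nlinarith [Real.exp_pos A]
  exact hJX.trans (mul_le_mul hexp hXle (Real.sqrt_nonneg _) (by positivity))
end

section
/- Let T > 0, let I and J be absolutely continuous nonnegative real-valued functions on [0,T] with J ∈ L²(0,T), and let a, c ∈ L¹(0,T) and b ∈ L²(0,T) be nonnegative functions. If I′(t) + J(t)² ≤ a(t)·I(t) + b(t)·J(t) + c(t) for a.e. t ∈ [0,T], then ‖I‖_{L^∞(0,T)} ≤ C̃_a · ( I(0) + ‖c‖_{L¹(0,T)} + ‖b‖²_{L²(0,T)} ), where C̃_a = e^A · ( 1 + (3/2)·(1 + A·e^A)² ) and A = ‖a‖_{L¹(0,T)}. In particular the constant depends only on ‖a‖_{L¹(0,T)}. -/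
open MeasureTheory

open Filter

/-- Post-composing an absolutely continuous function with a Lipschitz function yields an absolutely
continuous function. -/
theorem LipschitzOnWith.comp_absolutelyContinuousOnInterval {X Y : Type*} [PseudoMetricSpace X]
    [PseudoMetricSpace Y] {φ : X → Y} {f : ℝ → X} {K : NNReal} {s : Set X} {a b : ℝ}
    (hφ : LipschitzOnWith K φ s) (hf : AbsolutelyContinuousOnInterval f a b)
    (hs : Set.MapsTo f (Set.uIcc a b) s) :
    AbsolutelyContinuousOnInterval (fun x => φ (f x)) a b := by
  unfold AbsolutelyContinuousOnInterval at hf ⊢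
  have hK := hf.const_mul (K : ℝ)
  rw [mul_zero] at hK
  refine squeeze_zero' (Eventually.of_forall fun E => Finset.sum_nonneg fun i _ => dist_nonneg)
    ?_ hK
  filter_upwards [mem_inf_of_right (mem_principal_self _)] with E hE
  rw [Finset.mul_sum]
  refine Finset.sum_le_sum fun i hi => ?_
  have hmem := hE.1 i hi
  exact hφ.dist_le_mul _ (hs hmem.1) _ (hs hmem.2)

/-- **Grönwall's inequality** for absolutely continuous functions with integrable coefficients. -/
theorem IsACOn.le_exp_integral_mul {f f' a g : ℝ → ℝ} {T : ℝ} (hf : IsACOn f f' T)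
    (ha : IntegrableOn a (Set.Ioc 0 T)) (hg : IntegrableOn g (Set.Ioc 0 T))
    (ha0 : ∀ᵐ t ∂(volume.restrict (Set.Ioc 0 T)), 0 ≤ a t)
    (hg0 : ∀ᵐ t ∂(volume.restrict (Set.Ioc 0 T)), 0 ≤ g t)
    (hle : ∀ᵐ t ∂(volume.restrict (Set.Ioc 0 T)), f' t ≤ a t * f t + g t)
    {t : ℝ} (ht : t ∈ Set.Icc 0 T) :
    f t ≤ Real.exp (∫ s in (0:ℝ)..t, a s) * (f 0 + ∫ s in (0:ℝ)..t, g s) := by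
  have hsub : Set.Ioc 0 t ⊆ Set.Ioc 0 T := Set.Ioc_subset_Ioc_right ht.2
  have hf't : IntervalIntegrable f' volume 0 t :=
    (intervalIntegrable_iff_integrableOn_Ioc_of_le ht.1).2 (hf.1.mono_set hsub)
  have hat : IntervalIntegrable a volume 0 t :=
    (intervalIntegrable_iff_integrableOn_Ioc_of_le ht.1).2 (ha.mono_set hsub)
  have hgt : IntervalIntegrable g volume 0 t :=
    (intervalIntegrable_iff_integrableOn_Ioc_of_le ht.1).2 (hg.mono_set hsub)
  set F : ℝ → ℝ := fun x => f 0 + ∫ s in (0:ℝ)..x, f' s with hF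
  set P : ℝ → ℝ := fun x => ∫ s in (0:ℝ)..x, a s with hP
  set E : ℝ → ℝ := fun x => Real.exp (-P x) with hE
  have hPac : AbsolutelyContinuousOnInterval P 0 t :=
    hat.absolutelyContinuousOnInterval_intervalIntegral (c := 0) (by simp)
  have hFac : AbsolutelyContinuousOnInterval F 0 t :=
    (LipschitzWith.const (f 0)).lipschitzOnWith.absolutelyContinuousOnInterval.fun_add
      (hf't.absolutelyContinuousOnInterval_intervalIntegral (c := 0) (by simp))
  have hEac : AbsolutelyContinuousOnInterval E 0 t := by
    obtain ⟨C, hC⟩ := hPac.exists_bound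
    have hexp : ContDiffOn ℝ 1 (fun x : ℝ => Real.exp (-x)) (Set.Icc (-C) C) :=
      (Real.contDiff_exp.comp contDiff_neg).contDiffOn
    obtain ⟨K, hK⟩ := hexp.exists_lipschitzOnWith (by decide) (convex_Icc _ _) isCompact_Icc
    exact hK.comp_absolutelyContinuousOnInterval hPac fun x hx => abs_le.1 (hC x hx)
  have hprod := hFac.integral_deriv_mul_eq_sub hEac
  have hmono : ∫ x in (0:ℝ)..t, deriv F x * E x + F x * deriv E x ≤ ∫ x in (0:ℝ)..t, g x := by
    refine intervalIntegral.integral_mono_ae_restrict ht.1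
      ((hFac.intervalIntegrable_deriv.mul_continuousOn hEac.continuousOn).add
        (hEac.intervalIntegrable_deriv.continuousOn_mul hFac.continuousOn)) hgt ?_
    rw [← Measure.restrict_congr_set Ioc_ae_eq_Icc]
    have hdF := ae_restrict_of_ae (s := Set.Ioc 0 t) hf't.ae_hasDerivAt_integral
    have hdP := ae_restrict_of_ae (s := Set.Ioc 0 t) hat.ae_hasDerivAt_integral
    filter_upwards [hdF, hdP, ae_restrict_of_ae_restrict_of_subset hsub ha0,
      ae_restrict_of_ae_restrict_of_subset hsub hg0,
      ae_restrict_of_ae_restrict_of_subset hsub hle,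
      ae_restrict_mem measurableSet_Ioc] with x hxF hxP hxa hxg hxle hx
    have hxu : x ∈ Set.uIcc 0 t := by
      rw [Set.uIcc_of_le ht.1]; exact Set.Ioc_subset_Icc_self hx
    have hF' : HasDerivAt F (f' x) x := (hxF hxu 0 (by simp)).const_add _
    have hE' : HasDerivAt E (E x * -a x) x := (hxP hxu 0 (by simp)).neg.exp
    have hFx : f x = F x := hf.2 x ⟨hx.1.le, hx.2.trans ht.2⟩
    have hP0 : 0 ≤ P x := by
      refine intervalIntegral.integral_nonneg_of_ae_restrict hx.1.le ?_
      rw [← Measure.restrict_congr_set Ioc_ae_eq_Icc]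
      exact ae_restrict_of_ae_restrict_of_subset
        (Set.Ioc_subset_Ioc_right (hx.2.trans ht.2)) ha0
    have hE0 : 0 < E x := Real.exp_pos _
    have hE1 : E x ≤ 1 := Real.exp_le_one_iff.2 (neg_nonpos.2 hP0)
    rw [hF'.deriv, hE'.deriv]
    rw [hFx] at hxle
    calc f' x * E x + F x * (E x * -a x) = (f' x - a x * F x) * E x := by ring
      _ ≤ g x * E x := by gcongr; linarith
      _ ≤ g x := mul_le_of_le_one_right hxg hE1
  have hF0 : F 0 = f 0 := by simp [hF]
  have hE0 : E 0 = 1 := by simp [hE, hP]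
  have hFt : f t = F t := hf.2 t ht
  have hEt : Real.exp (P t) * E t = 1 := by rw [hE, ← Real.exp_add]; simp
  rw [hprod, hF0, hE0, mul_one] at hmono
  calc f t = Real.exp (P t) * (F t * E t) := by
        rw [hFt, mul_left_comm, hEt, mul_one]
    _ ≤ Real.exp (P t) * (f 0 + ∫ s in (0:ℝ)..t, g s) := by gcongr; linarith

theorem mixed_gronwall_Linf_bound
    (T : ℝ) (hT : 0 < T) (I I' J J' a b c : ℝ → ℝ)
    (hI : IsACOn I I' T) (hJ : IsACOn J J' T)
    (hInn : ∀ t ∈ Set.Icc 0 T, 0 ≤ I t)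
    (hJnn : ∀ t ∈ Set.Icc 0 T, 0 ≤ J t)
    (hJL2 : IntegrableOn (fun t => (J t)^2) (Set.Ioc 0 T))
    (haint : IntegrableOn a (Set.Ioc 0 T))
    (hcint : IntegrableOn c (Set.Ioc 0 T))
    (hbint : IntegrableOn (fun t => (b t)^2) (Set.Ioc 0 T))
    (hann : ∀ᵐ t ∂(volume.restrict (Set.Ioo 0 T)), 0 ≤ a t)
    (hbnn : ∀ᵐ t ∂(volume.restrict (Set.Ioo 0 T)), 0 ≤ b t)
    (hcnn : ∀ᵐ t ∂(volume.restrict (Set.Ioo 0 T)), 0 ≤ c t)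
    (hineq : ∀ᵐ t ∂(volume.restrict (Set.Ioo 0 T)),
      I' t + (J t)^2 ≤ a t * I t + b t * J t + c t)
    :
    LInfN I T ≤ Real.exp (L1N a T) * (1 + 3/2 * (1 + L1N a T * Real.exp (L1N a T))^2) *
      (I 0 + L1N c T + (L2N b T)^2) := by
  rw [Measure.restrict_congr_set Ioo_ae_eq_Ioc] at hann hcnn hineq
  have hle : ∀ᵐ t ∂(volume.restrict (Set.Ioc 0 T)), I' t ≤ a t * I t + (c t + (b t)^2) := by
    filter_upwards [hineq] with t ht
    nlinarith [sq_nonneg (b t - 2 * J t), sq_nonneg (b t)]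
  have hg0 : ∀ᵐ t ∂(volume.restrict (Set.Ioc 0 T)), 0 ≤ c t + (b t)^2 := by
    filter_upwards [hcnn] with t ht
    positivity
  have hii {f : ℝ → ℝ} (hf : IntegrableOn f (Set.Ioc 0 T)) : IntervalIntegrable f volume 0 T :=
    (intervalIntegrable_iff_integrableOn_Ioc_of_le hT.le).2 hf
  have hL1 {f : ℝ → ℝ} (hf : ∀ᵐ t ∂(volume.restrict (Set.Ioc 0 T)), 0 ≤ f t) :
      L1N f T = ∫ s in (0:ℝ)..T, f s := by
    refine intervalIntegral.integral_congr_ae_restrict ?_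
    rw [Set.uIoc_of_le hT.le]
    filter_upwards [hf] with t ht using abs_of_nonneg ht
  have hmono {f : ℝ → ℝ} (hf : IntegrableOn f (Set.Ioc 0 T))
      (hf0 : ∀ᵐ t ∂(volume.restrict (Set.Ioc 0 T)), 0 ≤ f t) {t : ℝ} (ht : t ∈ Set.Icc 0 T) :
      ∫ s in (0:ℝ)..t, f s ≤ ∫ s in (0:ℝ)..T, f s :=
    intervalIntegral.integral_mono_interval le_rfl ht.1 ht.2 hf0 (hii hf)
  have hgint : IntegrableOn (fun t => c t + (b t)^2) (Set.Ioc 0 T) := hcint.add hbint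
  have hL2 : (L2N b T)^2 = ∫ s in (0:ℝ)..T, (b s)^2 :=
    Real.sq_sqrt (intervalIntegral.integral_nonneg hT.le fun s _ => sq_nonneg (b s))
  have hgT : ∫ s in (0:ℝ)..T, (c s + (b s)^2) = L1N c T + (L2N b T)^2 := by
    rw [hL2, hL1 hcnn, intervalIntegral.integral_add (hii hcint) (hii hbint)]
  have hc0 : 0 ≤ L1N c T := intervalIntegral.integral_nonneg hT.le fun s _ => abs_nonneg _
  have hI0 : 0 ≤ I 0 := hInn 0 ⟨le_rfl, hT.le⟩
  have hbound : ∀ t ∈ Set.Icc 0 T,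
      I t ≤ Real.exp (L1N a T) * (I 0 + L1N c T + (L2N b T)^2) := fun t ht =>
    calc I t ≤ Real.exp (∫ s in (0:ℝ)..t, a s) * (I 0 + ∫ s in (0:ℝ)..t, (c s + (b s)^2)) :=
          hI.le_exp_integral_mul haint hgint hann hg0 hle ht
      _ ≤ Real.exp (L1N a T) * (I 0 + ∫ s in (0:ℝ)..T, (c s + (b s)^2)) := by
          rw [hL1 hann]
          refine (mul_le_mul_of_nonneg_left (add_le_add_right (hmono hgint hg0 ht) _)
            (Real.exp_pos _).le).trans
            (mul_le_mul_of_nonneg_right (Real.exp_le_exp.2 (hmono haint hann ht)) ?_)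
          rw [hgT]; positivity
      _ = _ := by rw [hgT, add_assoc]
  have : NeZero (volume.restrict (Set.Ioo 0 T)) :=
    ⟨by simp [Measure.restrict_eq_zero, hT]⟩
  refine essSup_le_of_ae_le _ ?_
    (IsBoundedUnder.isCoboundedUnder_le (isBoundedUnder_of ⟨0, fun t => abs_nonneg (I t)⟩))
  filter_upwards [ae_restrict_mem measurableSet_Ioo] with t ht
  have htI := Set.Ioo_subset_Icc_self ht
  rw [abs_of_nonneg (hInn t htI)]
  refine (hbound t htI).trans ?_
  gcongr
  refine le_mul_of_one_le_right (Real.exp_pos _).le ?_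
  linarith [sq_nonneg (1 + L1N a T * Real.exp (L1N a T))]
end

section
/- Let T > 0, let I and J be absolutely continuous nonnegative real-valued functions on [0,T] with J ∈ L²(0,T), and let a, c ∈ L¹(0,T) and b ∈ L²(0,T) be nonnegative functions. If I′(t) + J(t)² ≤ a(t)·I(t) + b(t)·J(t) + c(t) for a.e. t ∈ [0,T], then there exists a constant C > 0, depending only on ‖a‖_{L¹(0,T)}, such that simultaneously ‖J‖_{L²(0,T)} ≤ C·( √(I(0)) + √(‖c‖_{L¹(0,T)}) + ‖b‖_{L²(0,T)} ) and ‖I‖_{L^∞(0,T)} ≤ C·( I(0) + ‖c‖_{L¹(0,T)} + ‖b‖²_{L²(0,T)} ). -/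
open MeasureTheory

open Set Filter Topology

/-- Postcomposition with a continuously differentiable function preserves absolute continuity. -/
theorem ContDiff.comp_absolutelyContinuousOnInterval {g f : ℝ → ℝ} {a b : ℝ}
    (hg : ContDiff ℝ 1 g) (hf : AbsolutelyContinuousOnInterval f a b) :
    AbsolutelyContinuousOnInterval (fun x => g (f x)) a b := by
  obtain ⟨M, hM⟩ := hf.exists_bound
  obtain ⟨K, hK⟩ := (hg.contDiffOn (s := Icc (-M) M)).exists_lipschitzOnWith
    (by decide) (convex_Icc _ _) isCompact_Icc
  have hmem : ∀ x ∈ uIcc a b, f x ∈ Icc (-M) M := fun x hx => abs_le.mp (hM x hx)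
  unfold AbsolutelyContinuousOnInterval at hf
  refine squeeze_zero' (Eventually.of_forall fun _ => Finset.sum_nonneg fun _ _ => dist_nonneg) ?_
    (by simpa using hf.const_mul (K : ℝ))
  rw [eventually_inf_principal]
  filter_upwards with E hE
  rw [Finset.mul_sum]
  exact Finset.sum_le_sum fun i hi =>
    hK.dist_le_mul _ (hmem _ (hE.1 i hi).1) _ (hmem _ (hE.1 i hi).2)

/-- **Grönwall's inequality** for absolutely continuous functions with `L¹` coefficients. -/
theorem IsACOn.le_exp_mul_of_ae_le {f f' a g : ℝ → ℝ} {T : ℝ} (hf : IsACOn f f' T)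
    (ha : IntegrableOn a (Ioc 0 T)) (hg : IntegrableOn g (Ioc 0 T))
    (ha₀ : ∀ᵐ t ∂volume.restrict (Ioo 0 T), 0 ≤ a t)
    (hg₀ : ∀ᵐ t ∂volume.restrict (Ioo 0 T), 0 ≤ g t)
    (hle : ∀ᵐ t ∂volume.restrict (Ioo 0 T), f' t ≤ a t * f t + g t)
    {t : ℝ} (ht : t ∈ Icc 0 T) :
    f t ≤ Real.exp (∫ s in (0:ℝ)..t, a s) * (f 0 + ∫ s in (0:ℝ)..t, g s) := by
  have ht₀ : 0 ≤ t := ht.1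
  have hsub : Ioc 0 t ⊆ Ioc 0 T := Ioc_subset_Ioc_right ht.2
  have hii : ∀ {u : ℝ → ℝ}, IntegrableOn u (Ioc 0 T) → IntervalIntegrable u volume 0 t :=
    fun hu => (intervalIntegrable_iff_integrableOn_Ioc_of_le ht₀).2 (hu.mono_set hsub)
  have h0 : (0:ℝ) ∈ uIcc 0 t := left_mem_uIcc
  set F : ℝ → ℝ := fun x => f 0 + ∫ s in (0:ℝ)..x, f' s with hF
  set A : ℝ → ℝ := fun x => ∫ s in (0:ℝ)..x, a s with hA
  have hconst : AbsolutelyContinuousOnInterval (fun _ : ℝ => f 0) 0 t :=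
    ContDiffOn.absolutelyContinuousOnInterval contDiffOn_const
  have hFac : AbsolutelyContinuousOnInterval F 0 t :=
    hconst.fun_add ((hii hf.1).absolutelyContinuousOnInterval_intervalIntegral h0)
  have hAac : AbsolutelyContinuousOnInterval A 0 t :=
    (hii ha).absolutelyContinuousOnInterval_intervalIntegral h0
  have hEac : AbsolutelyContinuousOnInterval (fun x => Real.exp (-A x)) 0 t :=
    Real.contDiff_exp.comp_absolutelyContinuousOnInterval hAac.fun_neg
  have hprod := hFac.integral_deriv_mul_eq_sub hEac
  have hA₀ : ∀ x ∈ Icc 0 T, 0 ≤ A x := fun x hx => by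
    simp only [hA, intervalIntegral.integral_of_le hx.1, integral_Ioc_eq_integral_Ioo]
    exact setIntegral_nonneg_of_ae_restrict
      (ae_restrict_of_ae_restrict_of_subset (Ioo_subset_Ioo_right hx.2) ha₀)
  have hmono : ∫ x in (0:ℝ)..t, deriv F x * Real.exp (-A x)
        + F x * deriv (fun x => Real.exp (-A x)) x ≤ ∫ x in (0:ℝ)..t, g x := by
    refine intervalIntegral.integral_mono_ae_restrict ht₀
      ((hFac.intervalIntegrable_deriv.mul_continuousOn hEac.continuousOn).add
        (hEac.intervalIntegrable_deriv.continuousOn_mul hFac.continuousOn)) (hii hg) ?_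
    rw [← restrict_Ioo_eq_restrict_Icc]
    have hsub' : Ioo 0 t ⊆ Ioo 0 T := Ioo_subset_Ioo_right ht.2
    filter_upwards [ae_restrict_of_ae_restrict_of_subset hsub' hg₀,
      ae_restrict_of_ae_restrict_of_subset hsub' hle,
      ae_restrict_of_ae (hii hf.1).ae_hasDerivAt_integral,
      ae_restrict_of_ae (hii ha).ae_hasDerivAt_integral,
      ae_restrict_mem measurableSet_Ioo] with x hgx hlex hfx hax hx
    have hx' : x ∈ uIcc 0 t := by rw [uIcc_of_le ht₀]; exact Ioo_subset_Icc_self hx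
    have hxT : x ∈ Icc 0 T := ⟨hx.1.le, hx.2.le.trans ht.2⟩
    have hFd : deriv F x = f' x := ((hfx hx' 0 h0).const_add (f 0)).deriv
    have hEd : deriv (fun x => Real.exp (-A x)) x = Real.exp (-A x) * -a x :=
      (hax hx' 0 h0).neg.exp.deriv
    have hE₁ : Real.exp (-A x) ≤ 1 := Real.exp_le_one_iff.2 (neg_nonpos.2 (hA₀ x hxT))
    have hFx : F x = f x := (hf.2 x hxT).symm
    rw [hFd, hEd, hFx]
    calc f' x * Real.exp (-A x) + f x * (Real.exp (-A x) * -a x)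
        = (f' x - a x * f x) * Real.exp (-A x) := by ring
      _ ≤ g x * Real.exp (-A x) := by gcongr; linarith
      _ ≤ g x := mul_le_of_le_one_right hgx hE₁
  have hFt : F t = f t := (hf.2 t ht).symm
  have hF0 : F 0 = f 0 := by simp [hF]
  have hE0 : Real.exp (-A 0) = 1 := by simp [hA]
  rw [hprod, hFt, hF0, hE0, mul_one, Real.exp_neg] at hmono
  have hpos := Real.exp_pos (A t)
  calc f t = Real.exp (A t) * (f t * (Real.exp (A t))⁻¹) := by field_simp
    _ ≤ Real.exp (A t) * (f 0 + ∫ s in (0:ℝ)..t, g s) := by gcongr; linarith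

theorem LInfN_le_of_forall_abs_le {f : ℝ → ℝ} {T K : ℝ} (hT : 0 < T)
    (h : ∀ t ∈ Ioo 0 T, |f t| ≤ K) : LInfN f T ≤ K := by
  have : NeBot (ae (volume.restrict (Ioo 0 T))) := by
    rw [ae_neBot, Ne, Measure.restrict_eq_zero]
    simp [hT]
  exact essSup_le_of_ae_le K ((ae_restrict_mem measurableSet_Ioo).mono h)
    (isCoboundedUnder_le_of_le _ (fun _ => abs_nonneg _))

theorem L1N_eq_integral {f : ℝ → ℝ} {T : ℝ} (hT : 0 ≤ T)
    (hf : ∀ᵐ t ∂volume.restrict (Ioo 0 T), 0 ≤ f t) : L1N f T = ∫ s in (0:ℝ)..T, f s := by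
  simp only [L1N, intervalIntegral.integral_of_le hT, integral_Ioc_eq_integral_Ioo]
  exact integral_congr_ae (hf.mono fun t ht => abs_of_nonneg ht)

theorem integral_le_L1N {f : ℝ → ℝ} {t T : ℝ} (ht : 0 ≤ t) (htT : t ≤ T)
    (hf : IntegrableOn f (Ioc 0 T)) : ∫ s in (0:ℝ)..t, f s ≤ L1N f T := by
  have hii : ∀ u ∈ Icc 0 T, IntervalIntegrable f volume 0 u := fun u hu =>
    (intervalIntegrable_iff_integrableOn_Ioc_of_le hu.1).2
      (hf.mono_set (Ioc_subset_Ioc_right hu.2))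
  calc ∫ s in (0:ℝ)..t, f s ≤ ∫ s in (0:ℝ)..t, |f s| :=
        intervalIntegral.integral_mono_on ht (hii t ⟨ht, htT⟩) (hii t ⟨ht, htT⟩).abs
          fun s _ => le_abs_self _
    _ ≤ L1N f T := intervalIntegral.integral_mono_interval le_rfl ht htT
        (Eventually.of_forall fun s => abs_nonneg _) (hii T ⟨ht.trans htT, le_rfl⟩).abs

theorem Real.sqrt_add_add_sq_le {x y z : ℝ} (hx : 0 ≤ x) (hy : 0 ≤ y) (hz : 0 ≤ z) :
    √(x + y + z ^ 2) ≤ √x + √y + z := by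
  refine Real.sqrt_le_iff.2 ⟨by positivity, ?_⟩
  nlinarith [Real.sq_sqrt hx, Real.sq_sqrt hy, mul_nonneg (Real.sqrt_nonneg x) (Real.sqrt_nonneg y),
    mul_nonneg (Real.sqrt_nonneg x) hz, mul_nonneg (Real.sqrt_nonneg y) hz]

/-- There is a constant depending only on `‖a‖_{L¹(0,T)}` (i.e. a function
`C : ℝ → ℝ` evaluated at `‖a‖_{L¹(0,T)}`) which is positive and for which both
the `L²` bound on `J` and the `L^∞` bound on `I` hold, for all data satisfying
the hypotheses. -/
theorem mixed_gronwall_exists_constant :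
    ∃ C : ℝ → ℝ, ∀ (T : ℝ), 0 < T → ∀ (I I' J J' a b c : ℝ → ℝ),
      IsACOn I I' T → IsACOn J J' T →
      (∀ t ∈ Set.Icc 0 T, 0 ≤ I t) →
      (∀ t ∈ Set.Icc 0 T, 0 ≤ J t) →
      IntegrableOn (fun t => (J t)^2) (Set.Ioc 0 T) →
      IntegrableOn a (Set.Ioc 0 T) →
      IntegrableOn c (Set.Ioc 0 T) →
      IntegrableOn (fun t => (b t)^2) (Set.Ioc 0 T) →
      (∀ᵐ t ∂(volume.restrict (Set.Ioo 0 T)), 0 ≤ a t) →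
      (∀ᵐ t ∂(volume.restrict (Set.Ioo 0 T)), 0 ≤ b t) →
      (∀ᵐ t ∂(volume.restrict (Set.Ioo 0 T)), 0 ≤ c t) →
      (∀ᵐ t ∂(volume.restrict (Set.Ioo 0 T)),
        I' t + (J t)^2 ≤ a t * I t + b t * J t + c t) →
      0 < C (L1N a T) ∧
      L2N J T ≤ C (L1N a T) * (Real.sqrt (I 0) + Real.sqrt (L1N c T) + L2N b T) ∧
      LInfN I T ≤ C (L1N a T) * (I 0 + L1N c T + (L2N b T)^2) := by
  refine ⟨fun x => 2 + 2 * |x| * Real.exp x + Real.exp x, ?_⟩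
  intro T hT I I' J J' a b c hI hJ hI₀ hJ₀ hJ2 ha hc hb2 ha₀ hb₀ hc₀ hle
  have hL1 : ∀ f : ℝ → ℝ, 0 ≤ L1N f T := fun f =>
    intervalIntegral.integral_nonneg hT.le fun _ _ => abs_nonneg _
  have hL2b : L2N b T ^ 2 = ∫ s in (0:ℝ)..T, b s ^ 2 :=
    Real.sq_sqrt (intervalIntegral.integral_nonneg hT.le fun _ _ => sq_nonneg _)
  have hI0 : 0 ≤ I 0 := hI₀ 0 ⟨le_rfl, hT.le⟩
  have hii : ∀ {u : ℝ → ℝ}, IntegrableOn u (Ioc 0 T) → IntervalIntegrable u volume 0 T :=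
    fun hu => (intervalIntegrable_iff_integrableOn_Ioc_of_le hT.le).2 hu
  set α := L1N a T with hα
  set g : ℝ → ℝ := fun t => b t ^ 2 / 2 + c t with hgdef
  have hg : IntegrableOn g (Ioc 0 T) := (hb2.div_const 2).add hc
  have hg₀ : ∀ᵐ t ∂volume.restrict (Ioo 0 T), 0 ≤ g t :=
    hc₀.mono fun t ht => by positivity
  have hyoung : ∀ᵐ t ∂volume.restrict (Ioo 0 T), I' t + J t ^ 2 / 2 ≤ a t * I t + g t :=
    hle.mono fun t ht => by
      simp only [hgdef]
      nlinarith [sq_nonneg (b t - J t)]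
  have hGM : L1N g T ≤ L1N c T + L2N b T ^ 2 := by
    rw [L1N_eq_integral hT.le hg₀, L1N_eq_integral hT.le hc₀, hL2b, hgdef,
      intervalIntegral.integral_add ((hii hb2).div_const 2) (hii hc),
      intervalIntegral.integral_div, ← hL2b]
    linarith [sq_nonneg (L2N b T)]
  set M := I 0 + L1N c T + L2N b T ^ 2 with hM
  have hM₀ : 0 ≤ M := by have := hL1 c; positivity
  have hbound : ∀ t ∈ Icc 0 T, I t ≤ Real.exp α * M := fun t ht => by
    refine (hI.le_exp_mul_of_ae_le ha hg ha₀ hg₀ ?_ ht).trans ?_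
    · exact hyoung.mono fun t ht => by linarith [sq_nonneg (J t)]
    · have h₁ := integral_le_L1N ht.1 ht.2 ha
      have h₂ := integral_le_L1N ht.1 ht.2 hg
      calc _ ≤ Real.exp (∫ s in (0:ℝ)..t, a s) * M := by gcongr; linarith
        _ ≤ Real.exp α * M := by gcongr
  have hJint : ∫ s in (0:ℝ)..T, J s ^ 2 ≤ 2 * (1 + α * Real.exp α) * M := by
    have hmono : ∫ s in (0:ℝ)..T, (I' s + J s ^ 2 / 2)
        ≤ ∫ s in (0:ℝ)..T, (a s * (Real.exp α * M) + g s) := by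
      refine intervalIntegral.integral_mono_ae_restrict hT.le
        ((hii hI.1).add ((hii hJ2).div_const 2)) (((hii ha).mul_const _).add (hii hg)) ?_
      rw [← restrict_Ioo_eq_restrict_Icc]
      filter_upwards [hyoung, ha₀, ae_restrict_mem measurableSet_Ioo] with t ht hat htT
      have := mul_le_mul_of_nonneg_left (hbound t (Ioo_subset_Icc_self htT)) hat
      linarith
    rw [intervalIntegral.integral_add (hii hI.1) ((hii hJ2).div_const 2),
      intervalIntegral.integral_add ((hii ha).mul_const _) (hii hg),
      intervalIntegral.integral_div, intervalIntegral.integral_mul_const,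
      ← L1N_eq_integral hT.le ha₀, ← L1N_eq_integral hT.le hg₀, ← hα] at hmono
    have hIT := hI.2 T ⟨hT.le, le_rfl⟩
    have hIT₀ := hI₀ T ⟨hT.le, le_rfl⟩
    linarith
  have hα₀ : 0 ≤ α := hL1 a
  have hE := Real.exp_pos α
  have hαE : 0 ≤ α * Real.exp α := by positivity
  simp only [abs_of_nonneg hα₀]
  set C := 2 + 2 * α * Real.exp α + Real.exp α with hC
  have hC₁ : 1 ≤ C := by linarith
  refine ⟨by linarith, ?_, ?_⟩
  · have hsum := Real.sqrt_add_add_sq_le hI0 (hL1 c) (Real.sqrt_nonneg _ : 0 ≤ L2N b T)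
    calc L2N J T ≤ √(C ^ 2 * M) := by
          refine Real.sqrt_le_sqrt (hJint.trans ?_)
          gcongr
          nlinarith
      _ = C * √M := by rw [Real.sqrt_mul (sq_nonneg _), Real.sqrt_sq (by linarith)]
      _ ≤ _ := mul_le_mul_of_nonneg_left hsum (by linarith)
  · refine LInfN_le_of_forall_abs_le hT fun t ht => ?_
    have htT := Ioo_subset_Icc_self ht
    rw [abs_of_nonneg (hI₀ t htT)]
    refine (hbound t htT).trans ?_
    gcongr
    linarith
end
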